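/- arXiv:2209.10522 — 2 statements merged into one kernel-verified Lean document; each statement's English description precedes it below -/
import Mathlib

section
/- For every complex s with Re(s) > 2, the Dirichlet series of c satisfies Σ_{k=1}^∞ c(k) k^{−s} = (1 − 2^{2−s}) ζ(s−1) (1 − 2^{1−s}) ζ(s), where ζ is the Riemann zeta function. -/
open scoped Real
open Complex

noncomputable section

/-- `c(n) = σ₁(n)` for odd `n`, `c(2^l m) = −3 σ₁(m)` for `l ≥ 1` and `m` odd. -/
def paperC (n : ℕ) : ℤ :=
  if Odd n then (ArithmeticFunction.sigma 1 n : ℤ)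
  else -3 * (ArithmeticFunction.sigma 1 (ordCompl[2] n) : ℤ)

/-- Dirichlet series of `σ₁`, indexed over `ℕ` (the term at `0` vanishes). -/
lemma hasSum_sigma_one_mul_cpow {s : ℂ} (hs : 2 < s.re) :
    HasSum (fun n : ℕ ↦ (ArithmeticFunction.sigma 1 n : ℂ) * (n : ℂ) ^ (-s))
      (riemannZeta (s - 1) * riemannZeta s) := by
  have h1 : LSeriesHasSum 1 s (riemannZeta s) := LSeriesHasSum_one (by linarith)
  have h2 : LSeriesHasSum (fun n : ℕ ↦ (n : ℂ)) s (riemannZeta (s - 1)) := by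
    have h : LSeriesHasSum 1 (s - 1) (riemannZeta (s - 1)) :=
      LSeriesHasSum_one (by simp; linarith)
    unfold LSeriesHasSum at h ⊢
    convert h using 1
    funext n
    rcases eq_or_ne n 0 with rfl | hn
    · simp
    · have hn' : (n : ℂ) ≠ 0 := by exact_mod_cast hn
      rw [LSeries.term_of_ne_zero hn, LSeries.term_of_ne_zero hn, cpow_sub _ _ hn', cpow_one]
      simp
  have h3 := h2.convolution h1
  unfold LSeriesHasSum at h3
  convert h3 using 2 with n
  rcases eq_or_ne n 0 with rfl | hn
  · simp
  · rw [LSeries.term_of_ne_zero hn, LSeries.convolution_def, cpow_neg, div_eq_mul_inv]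
    simp [Nat.sum_divisorsAntidiagonal (fun d _ ↦ (d : ℂ)), ArithmeticFunction.sigma_one_apply]

/-- Multiplying a Dirichlet series by `d⁻ˢ` dilates its coefficients by `d`. -/
lemma HasSum.dilate_cpow {f : ℕ → ℂ} {s a : ℂ} {d : ℕ} (hd : d ≠ 0)
    (hf : HasSum (fun n : ℕ ↦ f n * (n : ℂ) ^ (-s)) a) :
    HasSum (fun n : ℕ ↦ (if d ∣ n then f (n / d) else 0) * (n : ℂ) ^ (-s))
      ((d : ℂ) ^ (-s) * a) := by
  have hinj : Function.Injective (fun n : ℕ ↦ d * n) := mul_right_injective₀ hd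
  rw [← hinj.hasSum_iff]
  · have hcomp (n : ℕ) : (if d ∣ d * n then f (d * n / d) else 0) * ((d * n : ℕ) : ℂ) ^ (-s) =
        (d : ℂ) ^ (-s) * (f n * (n : ℂ) ^ (-s)) := by
      rw [if_pos (dvd_mul_right d n), Nat.mul_div_cancel_left n (Nat.pos_of_ne_zero hd),
        Nat.cast_mul, natCast_mul_natCast_cpow]
      ring
    simpa only [Function.comp_def, hcomp] using hf.mul_left ((d : ℂ) ^ (-s))
  · intro n hn
    have : ¬ d ∣ n := fun ⟨k, hk⟩ ↦ hn ⟨k, hk.symm⟩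
    simp [this]

lemma sigma_one_two_pow_mul {m : ℕ} (hm : Odd m) (l : ℕ) :
    (ArithmeticFunction.sigma 1 (2 ^ l * m) : ℤ) =
      (2 ^ (l + 1) - 1) * (ArithmeticFunction.sigma 1 m : ℤ) := by
  have hc : Nat.Coprime (2 ^ l) m := (Nat.coprime_two_left.mpr hm).pow_left l
  have hg := Nat.geomSum_eq (le_refl 2) (l + 1)
  rw [ArithmeticFunction.isMultiplicative_sigma.map_mul_of_coprime hc,
    ArithmeticFunction.sigma_one_apply_prime_pow Nat.prime_two, hg]
  simp

lemma paperC_eq_sigma (n : ℕ) :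
    paperC n = (ArithmeticFunction.sigma 1 n : ℤ)
      - 6 * (if 2 ∣ n then (ArithmeticFunction.sigma 1 (n / 2) : ℤ) else 0)
      + 8 * (if 4 ∣ n then (ArithmeticFunction.sigma 1 (n / 4) : ℤ) else 0) := by
  rcases eq_or_ne n 0 with rfl | hn
  · simp [paperC]
  obtain ⟨l, m, hm, rfl⟩ := Nat.exists_eq_two_pow_mul_odd hn
  have hcompl : ordCompl[2] (2 ^ l * m) = m := by
    rw [Nat.ordCompl_mul, Nat.ordCompl_self_pow Nat.prime_two,
      Nat.factorization_eq_zero_of_not_dvd (by simpa [← even_iff_two_dvd] using hm), pow_zero,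
      Nat.div_one, one_mul]
  match l with
  | 0 =>
    have h2 : ¬ 2 ∣ m := by simpa [← even_iff_two_dvd] using hm
    have h4 : ¬ 4 ∣ m := fun h ↦ h2 (dvd_trans (by norm_num) h)
    simp [paperC, hm, h2, h4]
  | 1 =>
    have h4 : ¬ 4 ∣ 2 ^ 1 * m := by have := hm; rw [Nat.odd_iff] at this; omega
    have ho : ¬ Odd (2 ^ 1 * m) := by simp
    have hd : 2 ^ 1 * m / 2 = m := by omega
    rw [paperC, if_neg ho, hcompl, if_neg h4, if_pos ⟨m, by ring⟩, hd, sigma_one_two_pow_mul hm]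
    ring
  | k + 2 =>
    have ho : ¬ Odd (2 ^ (k + 2) * m) := by simp [Nat.not_odd_iff_even, Nat.even_pow]
    have e2 : 2 ^ (k + 2) * m = 2 * (2 ^ (k + 1) * m) := by ring
    have e4 : 2 ^ (k + 2) * m = 4 * (2 ^ k * m) := by ring
    have hd2 : 2 ^ (k + 2) * m / 2 = 2 ^ (k + 1) * m := by omega
    have hd4 : 2 ^ (k + 2) * m / 4 = 2 ^ k * m := by omega
    rw [paperC, if_neg ho, hcompl, if_pos ⟨_, e2⟩, if_pos ⟨_, e4⟩, hd2, hd4,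
      sigma_one_two_pow_mul hm, sigma_one_two_pow_mul hm, sigma_one_two_pow_mul hm]
    ring

theorem dirichlet_series_c (s : ℂ) (hs : 2 < s.re) :
    ∑' k : ℕ, (paperC k : ℂ) * (k : ℂ) ^ (-s) =
      (1 - 2 ^ (2 - s)) * riemannZeta (s - 1) * ((1 - 2 ^ (1 - s)) * riemannZeta s) := by
  have h := hasSum_sigma_one_mul_cpow hs
  have h2 := h.dilate_cpow two_ne_zero
  have h4 := h.dilate_cpow four_ne_zero
  have key := (h.sub (h2.mul_left 6)).add (h4.mul_left 8)
  have e1 : (2 : ℂ) ^ (1 - s) = 2 * 2 ^ (-s) := by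
    rw [sub_eq_add_neg, cpow_add _ _ two_ne_zero, cpow_one]
  have e2 : (2 : ℂ) ^ (2 - s) = 4 * 2 ^ (-s) := by
    rw [sub_eq_add_neg, cpow_add _ _ two_ne_zero, cpow_ofNat]
    norm_num
  have e4 : ((4 : ℕ) : ℂ) ^ (-s) = 2 ^ (-s) * 2 ^ (-s) := by
    rw [show (4 : ℕ) = 2 * 2 from rfl, Nat.cast_mul, natCast_mul_natCast_cpow, Nat.cast_ofNat]
  rw [e1, e2]
  convert key.tsum_eq using 1
  · refine tsum_congr fun n ↦ ?_
    rw [paperC_eq_sigma]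
    push_cast
    ring
  · rw [e4, Nat.cast_ofNat]
    ring
end
end

section
/- For every complex s with Re(s) > 2, the Mellin transform identity ∫_0^∞ y^{s−1} ((θ₄(iy))⁴ − 1) dy = −8 π^{−s} Γ(s) Σ_{k=1}^∞ c(k) k^{−s} holds, where the integral converges absolutely. -/
open scoped Real
open Real Complex MeasureTheory

noncomputable section

/-- `θ₄(iy) = Σ_{n ∈ ℤ} (−1)^n e^{−π n² y}`. -/
def theta4 (y : ℝ) : ℝ := ∑' n : ℤ, (-1 : ℝ) ^ n * Real.exp (-(π * (n : ℝ) ^ 2 * y))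

/-- The weight two Eisenstein series as a function on `ℂ`, with arbitrary values off the upper
half-plane. -/
def eisensteinTwo (z : ℂ) : ℂ := EisensteinSeries.E2 (UpperHalfPlane.ofComplex z)

lemma eisensteinTwo_of_im_pos {z : ℂ} (hz : 0 < z.im) :
    eisensteinTwo z = EisensteinSeries.E2 ⟨z, hz⟩ := by
  rw [eisensteinTwo, UpperHalfPlane.ofComplex_apply_of_im_pos hz]

lemma hasSum_eisensteinTwo {z : ℂ} (hz : 0 < z.im) :
    HasSum (fun m : ℕ ↦ (if m = 0 then 1 else -24 * ArithmeticFunction.sigma 1 m : ℂ) *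
      cexp (2 * π * I * z) ^ m) (eisensteinTwo z) := by
  rw [eisensteinTwo_of_im_pos hz]
  exact EisensteinSeries.hasSum_qExpansion_E2 (z := ⟨z, hz⟩)

lemma eisensteinTwo_add_one {z : ℂ} (hz : 0 < z.im) :
    eisensteinTwo (z + 1) = eisensteinTwo z := by
  have hz' : 0 < (z + 1).im := by simpa using hz
  have h := hasSum_eisensteinTwo hz'
  have e : cexp (2 * π * I * (z + 1)) = cexp (2 * π * I * z) := by
    rw [mul_add, mul_one, Complex.exp_add, Complex.exp_two_pi_mul_I, mul_one]
  rw [e] at h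
  exact h.unique (hasSum_eisensteinTwo hz)

lemma conj_eisensteinTwo {z : ℂ} (hz : 0 < z.im) :
    (starRingEnd ℂ) (eisensteinTwo z) = eisensteinTwo (-(starRingEnd ℂ) z) := by
  have hz' : 0 < (-(starRingEnd ℂ) z).im := by simpa using hz
  refine HasSum.unique ?_ (hasSum_eisensteinTwo hz')
  convert! (Complex.hasSum_conj'.mpr (hasSum_eisensteinTwo hz)) using 2 with m
  rw [map_mul, map_pow, ← Complex.exp_conj]
  congr 1
  · split_ifs <;> simp [map_ofNat]
  · simp [map_ofNat]

lemma im_neg_one_div_pos {z : ℂ} (hz : 0 < z.im) : 0 < (-1 / z).im := by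
  simpa [neg_div, one_div, Complex.inv_im, neg_neg] using
    div_pos hz (Complex.normSq_pos.mpr fun h ↦ by simp [h] at hz)

lemma ne_zero_of_im_pos {z : ℂ} (hz : 0 < z.im) : z ≠ 0 := fun h ↦ by simp [h] at hz

lemma eisensteinTwo_neg_one_div {z : ℂ} (hz : 0 < z.im) :
    eisensteinTwo (-1 / z) = z ^ 2 * eisensteinTwo z + 6 * z / (π * I) := by
  have hz0 := ne_zero_of_im_pos hz
  have h := congr_fun (EisensteinSeries.E2_slash_action ModularGroup.S) ⟨z, hz⟩
  rw [SlashInvariantForm.slash_S_apply, Pi.sub_apply, Pi.smul_apply, EisensteinSeries.D2_S,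
    riemannZeta_two, smul_eq_mul] at h
  have e : (UpperHalfPlane.mk (-((⟨z, hz⟩ : UpperHalfPlane) : ℂ))⁻¹
      (UpperHalfPlane.im_inv_neg_coe_pos ⟨z, hz⟩)) = ⟨-1 / z, im_neg_one_div_pos hz⟩ := by
    ext
    simp [neg_div, inv_neg]
  rw [e] at h
  rw [eisensteinTwo_of_im_pos (im_neg_one_div_pos hz), eisensteinTwo_of_im_pos hz]
  generalize EisensteinSeries.E2 ⟨-1 / z, im_neg_one_div_pos hz⟩ = a at *
  generalize EisensteinSeries.E2 ⟨z, hz⟩ = b at *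
  have hpi : (π : ℂ) ≠ 0 := by exact_mod_cast Real.pi_ne_zero
  have h' : a * z ^ (-2 : ℤ) = b - 1 / (2 * ((π : ℂ) ^ 2 / 6)) * (2 * π * I / z) := h
  have hz2 : z ^ (-2 : ℤ) = 1 / z ^ 2 := by
    rw [zpow_neg, one_div]; norm_cast
  rw [hz2] at h'
  field_simp at h' ⊢
  linear_combination I * h' - 6 * z * Complex.I_sq

lemma differentiableAt_eisensteinTwo {z : ℂ} (hz : 0 < z.im) :
    DifferentiableAt ℂ eisensteinTwo z :=
  ((UpperHalfPlane.mdifferentiable_iff.mp E2_mdifferentiable).differentiableAt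
    (UpperHalfPlane.isOpen_upperHalfPlaneSet.mem_nhds hz) :)

open Filter Topology

lemma eventually_le_im (c : ℝ) : ∀ᶠ z : ℂ in comap Complex.im atTop, c ≤ z.im :=
  tendsto_comap.eventually (eventually_ge_atTop c)

lemma tendsto_cexp_mul_I_comap_im {c : ℝ} (hc : 0 < c) :
    Tendsto (fun z : ℂ ↦ cexp (c * I * z)) (comap Complex.im atTop) (𝓝 0) := by
  rw [tendsto_zero_iff_norm_tendsto_zero]
  simp only [Complex.norm_exp]
  have e (z : ℂ) : ((c : ℂ) * I * z).re = -(c * z.im) := by simp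
  simp only [e]
  exact Real.tendsto_exp_neg_atTop_nhds_zero.comp (tendsto_comap.const_mul_atTop hc)

lemma tendsto_eisensteinTwo : Tendsto eisensteinTwo (comap Complex.im atTop) (𝓝 1) := by
  set a : ℕ → ℂ := fun m ↦ if m = 0 then 1 else -24 * ArithmeticFunction.sigma 1 m with ha
  have hI : Summable fun m : ℕ ↦ ‖a m * cexp (2 * π * I * I) ^ m‖ :=
    (hasSum_eisensteinTwo (z := I) (by simp)).summable.norm
  have key : Tendsto (fun z : ℂ ↦ ∑' m : ℕ, a m * cexp (2 * π * I * z) ^ m)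
      (comap Complex.im atTop) (𝓝 (∑' m : ℕ, if m = 0 then (1 : ℂ) else 0)) := by
    refine tendsto_tsum_of_dominated_convergence hI (fun m ↦ ?_) ?_
    · have hq : Tendsto (fun z : ℂ ↦ cexp (2 * π * I * z)) (comap Complex.im atTop) (𝓝 0) := by
        simpa using tendsto_cexp_mul_I_comap_im Real.two_pi_pos
      rcases eq_or_ne m 0 with rfl | hm
      · simpa [ha] using tendsto_const_nhds
      · simpa [hm] using (hq.pow m).const_mul (a m)
    · filter_upwards [eventually_le_im 1] with z hz m
      rw [norm_mul, norm_mul, norm_pow, norm_pow]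
      gcongr ‖a m‖ * ?_ ^ m
      rw [Complex.norm_exp, Complex.norm_exp, Real.exp_le_exp]
      simpa using mul_le_mul_of_nonneg_left hz Real.two_pi_pos.le
  rw [tsum_ite_eq] at key
  refine key.congr' ?_
  filter_upwards [eventually_le_im 1] with z hz
  exact (hasSum_eisensteinTwo (by linarith)).tsum_eq

/-- The theta constant `θ₃`. -/
def thetaThree (τ : ℂ) : ℂ := jacobiTheta₂ 0 τ

/-- The theta constant `θ₄`. -/
def thetaFour (τ : ℂ) : ℂ := jacobiTheta₂ (1 / 2) τ

/-- The theta constant `θ₂`. -/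
def thetaTwo (τ : ℂ) : ℂ := cexp (π * I * τ / 4) * jacobiTheta₂ (τ / 2) τ

lemma cexp_pi_mul_I_mul_even {n : ℤ} (hn : Even n) : cexp (π * I * n) = 1 := by
  obtain ⟨k, rfl⟩ := hn
  rw [← Complex.exp_int_mul_two_pi_mul_I k]
  push_cast
  ring_nf

lemma jacobiTheta₂_add_half_add_one (z τ : ℂ) :
    jacobiTheta₂ (z + 1 / 2) (τ + 1) = jacobiTheta₂ z τ := by
  refine tsum_congr fun n ↦ ?_
  have h := cexp_pi_mul_I_mul_even (Int.even_mul_succ_self n)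
  rw [jacobiTheta₂_term, jacobiTheta₂_term, ← mul_one (cexp (2 * π * I * n * z + _))]
  conv_rhs => rw [← h]
  rw [← Complex.exp_add]
  push_cast
  ring_nf

lemma thetaFour_add_one (τ : ℂ) : thetaFour (τ + 1) = thetaThree τ := by
  simpa [thetaFour, thetaThree] using jacobiTheta₂_add_half_add_one 0 τ

lemma thetaThree_add_one (τ : ℂ) : thetaThree (τ + 1) = thetaFour τ := by
  rw [thetaThree, thetaFour, ← jacobiTheta₂_add_half_add_one (1 / 2), add_halves,
    ← jacobiTheta₂_add_left 0, zero_add]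

lemma thetaTwo_add_one_pow_four (τ : ℂ) : thetaTwo (τ + 1) ^ 4 = -thetaTwo τ ^ 4 := by
  rw [thetaTwo, thetaTwo, add_div, jacobiTheta₂_add_half_add_one, mul_pow, mul_pow,
    ← Complex.exp_nat_mul, ← Complex.exp_nat_mul, ← neg_mul]
  congr 1
  rw [← neg_one_mul, ← Complex.exp_pi_mul_I, ← Complex.exp_add]
  push_cast
  ring_nf

lemma cpow_half_pow_four (τ : ℂ) : ((-I * τ) ^ (1 / 2 : ℂ)) ^ 4 = -τ ^ 2 := by
  rw [← Complex.cpow_nat_mul]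
  norm_num
  rw [mul_pow, Complex.I_sq]
  ring

lemma thetaThree_neg_one_div {τ : ℂ} (hτ : 0 < τ.im) :
    thetaThree (-1 / τ) ^ 4 = -τ ^ 2 * thetaThree τ ^ 4 := by
  have h := jacobiTheta₂_functional_equation 0 τ
  have h0 := ne_zero_of_im_pos hτ
  rw [thetaThree, thetaThree, h, mul_pow, mul_pow, div_pow, cpow_half_pow_four τ]
  simp
  field_simp

lemma thetaTwo_neg_one_div {τ : ℂ} (hτ : 0 < τ.im) :
    thetaTwo (-1 / τ) ^ 4 = -τ ^ 2 * thetaFour τ ^ 4 := by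
  have h := jacobiTheta₂_functional_equation (1 / 2) τ
  have h0 := ne_zero_of_im_pos hτ
  rw [thetaFour, h, thetaTwo, ← jacobiTheta₂_neg_left, mul_pow, mul_pow, mul_pow, div_pow,
    cpow_half_pow_four τ]
  rw [show -π * I * (1 / 2) ^ 2 / τ = π * I * (-1 / τ) / 4 by ring,
    show -(-1 / τ / 2) = 1 / 2 / τ by ring]
  field_simp

lemma thetaFour_neg_one_div {τ : ℂ} (hτ : 0 < τ.im) :
    thetaFour (-1 / τ) ^ 4 = -τ ^ 2 * thetaTwo τ ^ 4 := by
  have h := jacobiTheta₂_functional_equation (τ / 2) τ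
  have h0 := ne_zero_of_im_pos hτ
  rw [thetaTwo, h, thetaFour, show τ / 2 / τ = 1 / 2 by field_simp,
    show -π * I * (τ / 2) ^ 2 / τ = -(π * I * τ / 4) by field_simp; ring, Complex.exp_neg,
    mul_pow, mul_pow, mul_pow, div_pow, cpow_half_pow_four τ]
  field_simp

lemma differentiableAt_thetaThree {τ : ℂ} (hτ : 0 < τ.im) : DifferentiableAt ℂ thetaThree τ :=
  differentiableAt_jacobiTheta₂_snd 0 hτ

lemma differentiableAt_thetaFour {τ : ℂ} (hτ : 0 < τ.im) : DifferentiableAt ℂ thetaFour τ :=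
  differentiableAt_jacobiTheta₂_snd (1 / 2) hτ

lemma differentiableAt_thetaTwo {τ : ℂ} (hτ : 0 < τ.im) : DifferentiableAt ℂ thetaTwo τ := by
  have h : DifferentiableAt ℂ (fun τ : ℂ ↦ jacobiTheta₂ (τ / 2) τ) τ :=
    (hasFDerivAt_jacobiTheta₂ (τ / 2) hτ).differentiableAt.comp τ
      (f := fun τ : ℂ ↦ (τ / 2, τ)) (by fun_prop)
  unfold thetaTwo
  fun_prop

lemma tendsto_comap_im_add_one :
    Tendsto (fun z : ℂ ↦ z + 1) (comap Complex.im atTop) (comap Complex.im atTop) := by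
  rw [tendsto_comap_iff]
  simpa [Function.comp_def] using tendsto_comap

lemma tendsto_comap_im_const_mul {c : ℝ} (hc : 0 < c) :
    Tendsto (fun z : ℂ ↦ c * z) (comap Complex.im atTop) (comap Complex.im atTop) := by
  rw [tendsto_comap_iff]
  simpa [Function.comp_def] using tendsto_comap.const_mul_atTop hc

lemma tendsto_thetaThree : Tendsto thetaThree (comap Complex.im atTop) (𝓝 1) := by
  have h := isBigO_at_im_infty_jacobiTheta_sub_one.trans_tendsto (g'' := fun τ : ℂ ↦
    rexp (-π * τ.im)) (by
      simpa [Function.comp_def, neg_mul] using Real.tendsto_exp_neg_atTop_nhds_zero.comp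
        (tendsto_comap.const_mul_atTop Real.pi_pos))
  unfold thetaThree
  simpa [funext jacobiTheta_eq_jacobiTheta₂] using h.add_const 1

lemma tendsto_thetaFour : Tendsto thetaFour (comap Complex.im atTop) (𝓝 1) :=
  (tendsto_thetaThree.comp tendsto_comap_im_add_one).congr thetaThree_add_one

lemma tendsto_thetaTwo : Tendsto thetaTwo (comap Complex.im atTop) (𝓝 0) := by
  have hI : Summable fun n : ℤ ↦ ‖jacobiTheta₂_term n (I / 2) I‖ :=
    ((summable_jacobiTheta₂_term_iff (I / 2) I).mpr (by simp)).norm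
  have hb : ∀ᶠ τ : ℂ in comap Complex.im atTop, ‖thetaTwo τ‖ ≤
      ‖cexp ((π / 4 : ℝ) * I * τ)‖ * ∑' n : ℤ, ‖jacobiTheta₂_term n (I / 2) I‖ := by
    filter_upwards [eventually_le_im 1] with τ hτ
    have hle (n : ℤ) : ‖jacobiTheta₂_term n (τ / 2) τ‖ ≤ ‖jacobiTheta₂_term n (I / 2) I‖ := by
      rw [norm_jacobiTheta₂_term, norm_jacobiTheta₂_term, Real.exp_le_exp]
      have h2 : 0 ≤ ((n * (n + 1) : ℤ) : ℝ) := by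
        exact_mod_cast (by rcases le_or_gt 0 n with h | h <;> nlinarith : 0 ≤ n * (n + 1))
      push_cast at h2
      have e : (τ / 2).im = τ.im / 2 := by simp
      have e' : (I / 2).im = 1 / 2 := by simp
      rw [e, e', Complex.I_im]
      nlinarith [mul_nonneg (mul_nonneg Real.pi_pos.le h2) (sub_nonneg.mpr hτ)]
    rw [thetaTwo, norm_mul, show (π : ℂ) * I * τ / 4 = (π / 4 : ℝ) * I * τ by push_cast; ring]
    gcongr
    exact tsum_of_norm_bounded hI.hasSum hle
  refine squeeze_zero_norm' hb ?_
  simpa using (tendsto_cexp_mul_I_comap_im (c := π / 4) (by positivity)).norm.mul_const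
    (∑' n : ℤ, ‖jacobiTheta₂_term n (I / 2) I‖)

/-- The difference between `θ₃ ^ 4` and the weight two Eisenstein series it is equal to. -/
def thetaThreeDefect (z : ℂ) : ℂ :=
  thetaThree z ^ 4 - (4 * eisensteinTwo (2 * z) - eisensteinTwo (z / 2)) / 3

/-- The difference between `θ₄ ^ 4` and the weight two Eisenstein series it is equal to. -/
def thetaFourDefect (z : ℂ) : ℂ :=
  thetaFour z ^ 4 - (4 * eisensteinTwo (2 * z) - eisensteinTwo ((z + 1) / 2)) / 3

/-- The difference between `θ₂ ^ 4` and the weight two Eisenstein series it is equal to. -/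
def thetaTwoDefect (z : ℂ) : ℂ :=
  thetaTwo z ^ 4 - (eisensteinTwo ((z + 1) / 2) - eisensteinTwo (z / 2)) / 3

lemma im_two_mul_pos {z : ℂ} (hz : 0 < z.im) : 0 < (2 * z).im := by simpa using hz

lemma im_half_pos {z : ℂ} (hz : 0 < z.im) : 0 < (z / 2).im := by simpa using hz

lemma im_add_one_half_pos {z : ℂ} (hz : 0 < z.im) : 0 < ((z + 1) / 2).im := by simpa using hz

lemma eisensteinTwo_two_mul_add_one {z : ℂ} (hz : 0 < z.im) :
    eisensteinTwo (2 * (z + 1)) = eisensteinTwo (2 * z) := by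
  rw [show 2 * (z + 1) = 2 * z + 1 + 1 by ring, eisensteinTwo_add_one (by simpa using hz),
    eisensteinTwo_add_one (im_two_mul_pos hz)]

lemma eisensteinTwo_add_one_add_one_half {z : ℂ} (hz : 0 < z.im) :
    eisensteinTwo ((z + 1 + 1) / 2) = eisensteinTwo (z / 2) := by
  rw [show (z + 1 + 1) / 2 = z / 2 + 1 by ring, eisensteinTwo_add_one (im_half_pos hz)]

lemma eisensteinTwo_two_mul_neg_one_div {z : ℂ} (hz : 0 < z.im) :
    eisensteinTwo (2 * (-1 / z)) = z ^ 2 / 4 * eisensteinTwo (z / 2) + 3 * z / (π * I) := by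
  have h0 := ne_zero_of_im_pos hz
  rw [show 2 * (-1 / z) = -1 / (z / 2) by field_simp, eisensteinTwo_neg_one_div (im_half_pos hz)]
  ring

lemma eisensteinTwo_neg_one_div_half {z : ℂ} (hz : 0 < z.im) :
    eisensteinTwo (-1 / z / 2) = 4 * z ^ 2 * eisensteinTwo (2 * z) + 12 * z / (π * I) := by
  have h0 := ne_zero_of_im_pos hz
  rw [show -1 / z / 2 = -1 / (2 * z) by field_simp, eisensteinTwo_neg_one_div (im_two_mul_pos hz)]
  ring

lemma eisensteinTwo_neg_one_div_add_one_half {z : ℂ} (hz : 0 < z.im) :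
    eisensteinTwo ((-1 / z + 1) / 2) =
      z ^ 2 * eisensteinTwo ((z + 1) / 2) + 12 * z / (π * I) := by
  have hu : 0 < ((z - 1) / 2).im := by simpa using hz
  have h0 := ne_zero_of_im_pos hz
  have hu0 : z - 1 ≠ 0 := fun h ↦ by simp [h] at hu
  have hpi : (π : ℂ) ≠ 0 := by exact_mod_cast Real.pi_ne_zero
  have e : -1 / ((z - 1) / 2) = -z / ((z - 1) / 2) + 1 + 1 := by field_simp; ring
  have hv : 0 < (-z / ((z - 1) / 2)).im := by simpa [e] using im_neg_one_div_pos hu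
  have h1 := eisensteinTwo_neg_one_div hu
  rw [e, eisensteinTwo_add_one (by simpa using hv), eisensteinTwo_add_one hv] at h1
  have h2 := eisensteinTwo_neg_one_div hv
  rw [show -1 / (-z / ((z - 1) / 2)) = (-1 / z + 1) / 2 by field_simp; ring, h1] at h2
  rw [h2, show (z + 1) / 2 = (z - 1) / 2 + 1 by ring, eisensteinTwo_add_one hu]
  field_simp
  ring

lemma thetaThreeDefect_add_one {z : ℂ} (hz : 0 < z.im) :
    thetaThreeDefect (z + 1) = thetaFourDefect z := by
  rw [thetaThreeDefect, thetaFourDefect, thetaThree_add_one, eisensteinTwo_two_mul_add_one hz]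

lemma thetaFourDefect_add_one {z : ℂ} (hz : 0 < z.im) :
    thetaFourDefect (z + 1) = thetaThreeDefect z := by
  rw [thetaThreeDefect, thetaFourDefect, thetaFour_add_one, eisensteinTwo_two_mul_add_one hz,
    eisensteinTwo_add_one_add_one_half hz]

lemma thetaTwoDefect_add_one {z : ℂ} (hz : 0 < z.im) :
    thetaTwoDefect (z + 1) = -thetaTwoDefect z := by
  rw [thetaTwoDefect, thetaTwoDefect, thetaTwo_add_one_pow_four,
    eisensteinTwo_add_one_add_one_half hz]
  ring

lemma thetaThreeDefect_neg_one_div {z : ℂ} (hz : 0 < z.im) :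
    thetaThreeDefect (-1 / z) = -z ^ 2 * thetaThreeDefect z := by
  rw [thetaThreeDefect, thetaThreeDefect, thetaThree_neg_one_div hz,
    eisensteinTwo_two_mul_neg_one_div hz, eisensteinTwo_neg_one_div_half hz]
  ring

lemma thetaFourDefect_neg_one_div {z : ℂ} (hz : 0 < z.im) :
    thetaFourDefect (-1 / z) = -z ^ 2 * thetaTwoDefect z := by
  rw [thetaFourDefect, thetaTwoDefect, thetaFour_neg_one_div hz,
    eisensteinTwo_two_mul_neg_one_div hz, eisensteinTwo_neg_one_div_add_one_half hz]
  ring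

lemma thetaTwoDefect_neg_one_div {z : ℂ} (hz : 0 < z.im) :
    thetaTwoDefect (-1 / z) = -z ^ 2 * thetaFourDefect z := by
  rw [thetaFourDefect, thetaTwoDefect, thetaTwo_neg_one_div hz,
    eisensteinTwo_neg_one_div_half hz, eisensteinTwo_neg_one_div_add_one_half hz]
  ring

/-- The sum of the squares of the three defects. -/
def thetaDefectSq (z : ℂ) : ℂ :=
  thetaThreeDefect z ^ 2 + thetaFourDefect z ^ 2 + thetaTwoDefect z ^ 2

lemma thetaDefectSq_add_one {z : ℂ} (hz : 0 < z.im) :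
    thetaDefectSq (z + 1) = thetaDefectSq z := by
  rw [thetaDefectSq, thetaThreeDefect_add_one hz, thetaFourDefect_add_one hz,
    thetaTwoDefect_add_one hz, thetaDefectSq]
  ring

lemma thetaDefectSq_neg_one_div {z : ℂ} (hz : 0 < z.im) :
    thetaDefectSq (-1 / z) = z ^ 4 * thetaDefectSq z := by
  rw [thetaDefectSq, thetaThreeDefect_neg_one_div hz, thetaFourDefect_neg_one_div hz,
    thetaTwoDefect_neg_one_div hz, thetaDefectSq]
  ring

lemma differentiableAt_thetaDefectSq {z : ℂ} (hz : 0 < z.im) :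
    DifferentiableAt ℂ thetaDefectSq z := by
  have h1 : DifferentiableAt ℂ (fun z ↦ eisensteinTwo (2 * z)) z :=
    (differentiableAt_eisensteinTwo (im_two_mul_pos hz)).comp z (f := fun z : ℂ ↦ 2 * z)
      (by fun_prop)
  have h2 : DifferentiableAt ℂ (fun z ↦ eisensteinTwo (z / 2)) z :=
    (differentiableAt_eisensteinTwo (im_half_pos hz)).comp z (f := fun z : ℂ ↦ z / 2)
      (by fun_prop)
  have h3 : DifferentiableAt ℂ (fun z ↦ eisensteinTwo ((z + 1) / 2)) z :=
    (differentiableAt_eisensteinTwo (im_add_one_half_pos hz)).comp z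
      (f := fun z : ℂ ↦ (z + 1) / 2) (by fun_prop)
  have h4 := differentiableAt_thetaThree hz
  have h5 := differentiableAt_thetaFour hz
  have h6 := differentiableAt_thetaTwo hz
  unfold thetaDefectSq thetaThreeDefect thetaFourDefect thetaTwoDefect
  fun_prop

lemma tendsto_thetaDefectSq : Tendsto thetaDefectSq (comap Complex.im atTop) (𝓝 0) := by
  have half : Tendsto (fun z : ℂ ↦ z / 2) (comap Complex.im atTop) (comap Complex.im atTop) := by
    refine (tendsto_comap_im_const_mul (c := 1 / 2) (by norm_num)).congr fun z ↦ ?_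
    push_cast
    ring
  have h1 : Tendsto (fun z : ℂ ↦ eisensteinTwo (2 * z)) (comap Complex.im atTop) (𝓝 1) :=
    tendsto_eisensteinTwo.comp (by simpa using tendsto_comap_im_const_mul (c := 2) two_pos)
  have h2 : Tendsto (fun z : ℂ ↦ eisensteinTwo (z / 2)) (comap Complex.im atTop) (𝓝 1) :=
    tendsto_eisensteinTwo.comp half
  have h3 : Tendsto (fun z : ℂ ↦ eisensteinTwo ((z + 1) / 2)) (comap Complex.im atTop) (𝓝 1) :=
    tendsto_eisensteinTwo.comp (half.comp tendsto_comap_im_add_one)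
  have h4 := (tendsto_thetaThree.pow 4).sub (((h1.const_mul 4).sub h2).div_const 3)
  have h5 := (tendsto_thetaFour.pow 4).sub (((h1.const_mul 4).sub h3).div_const 3)
  have h6 := (tendsto_thetaTwo.pow 4).sub ((h3.sub h2).div_const 3)
  convert! ((h4.pow 2).add (h5.pow 2)).add (h6.pow 2) using 2
  norm_num

lemma thetaDefectSq_slash (γ : Matrix.SpecialLinearGroup (Fin 2) ℤ) :
    SlashAction.map (4 : ℤ) γ (fun z : UpperHalfPlane ↦ thetaDefectSq z) =
      fun z : UpperHalfPlane ↦ thetaDefectSq z := by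
  refine SlashInvariantForm.slash_action_generators_SL2Z ?_ ?_ γ
  · ext z
    rw [SlashInvariantForm.slash_S_apply]
    have h := thetaDefectSq_neg_one_div z.im_pos
    have h0 : (z : ℂ) ≠ 0 := z.ne_zero
    rw [show (-1 / (z : ℂ)) = (-(z : ℂ))⁻¹ by rw [inv_neg, neg_div, one_div]] at h
    rw [UpperHalfPlane.coe_mk, h, zpow_neg]
    norm_cast
    field_simp
  · ext z
    rw [ModularForm.SL_slash_apply, UpperHalfPlane.modular_T_smul]
    have h : UpperHalfPlane.denom (ModularGroup.T : Matrix.GeneralLinearGroup (Fin 2) ℝ) z = 1 := by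
      rw [ModularGroup.denom_apply]
      simp [ModularGroup.coe_T]
    simp [h, add_comm (1 : ℂ), thetaDefectSq_add_one z.im_pos]

/-- The sum of the squares of the three defects is a level one cusp form of weight four. -/
def thetaDefectCuspForm :
    CuspForm (Matrix.SpecialLinearGroup.mapGL ℝ : Matrix.SpecialLinearGroup (Fin 2) ℤ →* _).range
      4 where
  toFun z := thetaDefectSq z
  slash_action_eq' := fun _ ⟨γ, hγ⟩ ↦ hγ ▸ thetaDefectSq_slash γ
  holo' := by
    refine UpperHalfPlane.mdifferentiable_iff.mpr fun z hz ↦ ?_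
    refine ((differentiableAt_thetaDefectSq hz).congr_of_eventuallyEq ?_).differentiableWithinAt
    filter_upwards [UpperHalfPlane.isOpen_upperHalfPlaneSet.mem_nhds hz] with w hw
    simp [UpperHalfPlane.ofComplex_apply_of_im_pos hw]
  zero_at_cusps' {c} hc := by
    rw [OnePoint.isZeroAt_iff_forall_SL2Z hc]
    intro γ _
    refine Tendsto.congr (fun z ↦ (congr_fun (thetaDefectSq_slash γ) z).symm) ?_
    exact tendsto_thetaDefectSq.comp UpperHalfPlane.tendsto_coe_atImInfty

lemma thetaDefectSq_eq_zero {z : ℂ} (hz : 0 < z.im) : thetaDefectSq z = 0 := by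
  have h : thetaDefectCuspForm = 0 := rank_zero_iff_forall_zero.mp
    (CuspForm.rank_eq_zero_of_weight_lt_twelve (by norm_num)) thetaDefectCuspForm
  exact congr_arg (fun f ↦ f ⟨z, hz⟩) h

lemma thetaFour_mul_I_pow_four {y : ℝ} (hy : 0 < y) :
    thetaFour (y * I) ^ 4 =
      (4 * eisensteinTwo (2 * (y * I)) - eisensteinTwo ((y * I + 1) / 2)) / 3 := by
  have hz : 0 < ((y : ℂ) * I).im := by simpa using hy
  have c1 : (starRingEnd ℂ) (eisensteinTwo (2 * (y * I))) = eisensteinTwo (2 * (y * I)) := by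
    rw [conj_eisensteinTwo (im_two_mul_pos hz)]
    simp [map_ofNat]
  have c2 : (starRingEnd ℂ) (eisensteinTwo (y * I / 2)) = eisensteinTwo (y * I / 2) := by
    rw [conj_eisensteinTwo (im_half_pos hz)]
    simp [map_ofNat, neg_div]
  have c3 : (starRingEnd ℂ) (eisensteinTwo ((y * I + 1) / 2)) =
      eisensteinTwo ((y * I + 1) / 2) := by
    rw [conj_eisensteinTwo (im_add_one_half_pos hz), ← eisensteinTwo_add_one
      (by rw [neg_im, conj_im, neg_neg]; exact im_add_one_half_pos hz)]
    congr 1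
    simp [map_ofNat]
    ring
  have t3 : (starRingEnd ℂ) (thetaThree (y * I)) = thetaThree (y * I) := by
    rw [thetaThree, jacobiTheta₂_conj]
    simp
  have t4 : (starRingEnd ℂ) (thetaFour (y * I)) = thetaFour (y * I) := by
    rw [thetaFour, jacobiTheta₂_conj]
    simp [map_ofNat]
  have t2 : (starRingEnd ℂ) (thetaTwo (y * I)) = thetaTwo (y * I) := by
    rw [thetaTwo, map_mul, jacobiTheta₂_conj, ← Complex.exp_conj, ← jacobiTheta₂_neg_left]
    simp [map_ofNat, neg_div]
  obtain ⟨a, ha⟩ : ∃ a : ℝ, thetaThreeDefect (y * I) = a :=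
    Complex.conj_eq_iff_real.mp (by simp [thetaThreeDefect, c1, c2, t3, map_ofNat])
  obtain ⟨b, hb⟩ : ∃ a : ℝ, thetaFourDefect (y * I) = a :=
    Complex.conj_eq_iff_real.mp (by simp [thetaFourDefect, c1, c3, t4, map_ofNat])
  obtain ⟨c, hc⟩ : ∃ a : ℝ, thetaTwoDefect (y * I) = a :=
    Complex.conj_eq_iff_real.mp (by simp [thetaTwoDefect, c2, c3, t2, map_ofNat])
  have h := thetaDefectSq_eq_zero hz
  rw [thetaDefectSq, ha, hb, hc] at h
  norm_cast at h
  have hb0 : b = 0 := by nlinarith [sq_nonneg a, sq_nonneg b, sq_nonneg c]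
  rw [hb0, thetaFourDefect, Complex.ofReal_zero, sub_eq_zero] at hb
  exact hb

lemma theta4_eq_thetaFour (y : ℝ) : (theta4 y : ℂ) = thetaFour (y * I) := by
  rw [theta4, thetaFour, jacobiTheta₂, Complex.ofReal_tsum]
  refine tsum_congr fun n ↦ ?_
  rw [jacobiTheta₂_term, Complex.exp_add]
  push_cast
  congr 1
  · rw [show 2 * π * I * n * (1 / 2) = n * (π * I) by ring, Complex.exp_int_mul,
      Complex.exp_pi_mul_I]
  · congr 1
    linear_combination (-π * n ^ 2 * y : ℂ) * I_sq

lemma paperC_zero : paperC 0 = 0 := by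
  simp [paperC]

lemma paperC_eq {n : ℕ} (hn : n ≠ 0) :
    paperC n = (if 4 ∣ n then 4 * (ArithmeticFunction.sigma 1 (n / 4) : ℤ) else 0) -
      (-1) ^ n * ArithmeticFunction.sigma 1 n := by
  obtain ⟨l, m, hm, rfl⟩ := Nat.exists_eq_two_pow_mul_odd hn
  have hcop (k : ℕ) : Nat.Coprime (2 ^ k) m := (Nat.coprime_two_left.mpr hm).pow_left k
  have hmul (k : ℕ) : (ArithmeticFunction.sigma 1 (2 ^ k * m) : ℤ) =
      (2 ^ (k + 1) - 1) * ArithmeticFunction.sigma 1 m := by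
    rw [ArithmeticFunction.isMultiplicative_sigma.map_mul_of_coprime (hcop k),
      ArithmeticFunction.sigma_one_apply_prime_pow Nat.prime_two, Nat.geomSum_eq le_rfl]
    simp [Nat.one_le_two_pow]
  have hord (k : ℕ) : ordCompl[2] (2 ^ k * m) = m := by
    have h2 : ¬ 2 ∣ m := hm.not_two_dvd_nat
    rw [Nat.factorization_mul (by positivity) hm.pos.ne']
    simp [Nat.factorization_eq_zero_of_not_dvd h2, Nat.prime_two.factorization_pow]
  match l with
  | 0 =>
    have h4 : ¬ 4 ∣ m := fun h ↦ hm.not_two_dvd_nat (dvd_trans (by norm_num) h)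
    simp [paperC, hm, h4, hm.neg_one_pow]
  | 1 =>
    have h4 : ¬ 4 ∣ 2 ^ 1 * m := fun h ↦ hm.not_two_dvd_nat (by lia)
    have he : Even (2 ^ 1 * m) := by simp
    rw [paperC, if_neg (Nat.not_odd_iff_even.mpr he), if_neg h4, hord, hmul, he.neg_one_pow]
    ring
  | k + 2 =>
    have h4 : 4 ∣ 2 ^ (k + 2) * m := ⟨2 ^ k * m, by ring⟩
    have he : Even (2 ^ (k + 2) * m) := by simp [pow_succ, parity_simps]
    rw [paperC, if_neg (Nat.not_odd_iff_even.mpr he), if_pos h4, hord,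
      show 2 ^ (k + 2) * m / 4 = 2 ^ k * m by rw [pow_add, mul_right_comm]; simp, hmul, hmul,
      he.neg_one_pow]
    ring

lemma norm_paperC_le (n : ℕ) : ‖(paperC n : ℂ)‖ ≤ 3 * ArithmeticFunction.sigma 1 n := by
  rw [Complex.norm_intCast]
  unfold paperC
  split_ifs with h
  · have : (0 : ℝ) ≤ ArithmeticFunction.sigma 1 n := Nat.cast_nonneg _
    push_cast
    rw [Nat.abs_cast]
    linarith
  · rcases eq_or_ne n 0 with rfl | hn
    · simp
    have : ArithmeticFunction.sigma 1 (ordCompl[2] n) ≤ ArithmeticFunction.sigma 1 n := by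
      rw [ArithmeticFunction.sigma_apply, ArithmeticFunction.sigma_apply]
      exact Finset.sum_le_sum_of_subset
        (Nat.divisors_subset_of_dvd hn (Nat.ordCompl_dvd n 2))
    push_cast
    rw [abs_mul, Nat.abs_cast, abs_neg, abs_of_pos three_pos]
    gcongr

lemma summable_norm_paperC_div_rpow {σ : ℝ} (hσ : 2 < σ) :
    Summable fun n : ℕ ↦ ‖(paperC n : ℂ)‖ / (n : ℝ) ^ σ := by
  have hz : LSeriesSummable
      (fun n ↦ ((ArithmeticFunction.zeta : ArithmeticFunction ℂ) n)) (σ : ℂ) :=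
    ArithmeticFunction.LSeriesSummable_zeta_iff.mpr (by rw [Complex.ofReal_re]; linarith)
  have hp : LSeriesSummable
      (fun n ↦ ((ArithmeticFunction.pow 1 : ArithmeticFunction ℂ) n)) (σ : ℂ) := by
    refine LSeriesSummable_of_le_const_mul_rpow (x := 2) (by simpa) ⟨1, fun n hn ↦ ?_⟩
    norm_num [ArithmeticFunction.pow_apply]
  have hs : LSeriesSummable (fun n ↦ (ArithmeticFunction.sigma 1 n : ℂ)) (σ : ℂ) := by
    have h := ArithmeticFunction.LSeriesSummable_mul hz hp
    have e : ((ArithmeticFunction.zeta : ArithmeticFunction ℂ)) *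
        ((ArithmeticFunction.pow 1 : ArithmeticFunction ℕ) : ArithmeticFunction ℂ) =
        ((ArithmeticFunction.sigma 1 : ArithmeticFunction ℕ) : ArithmeticFunction ℂ) := by
      rw [← ArithmeticFunction.zeta_mul_pow_eq_sigma, ArithmeticFunction.natCoe_mul]
    rw [e] at h
    exact h
  refine Summable.of_nonneg_of_le (fun n ↦ by positivity) (fun n ↦ ?_) (hs.norm.mul_left 3)
  rcases eq_or_ne n 0 with rfl | hn
  · simp [paperC_zero]
  rw [LSeries.norm_term_eq, if_neg hn, Complex.norm_natCast, Complex.ofReal_re, ← mul_div_assoc]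
  gcongr
  exact norm_paperC_le n

lemma hasSum_theta4_pow_four_sub_one {y : ℝ} (hy : 0 < y) :
    HasSum (fun n : ℕ ↦ -8 * (paperC n : ℂ) * rexp (-π * n * y)) ((theta4 y ^ 4 : ℝ) - 1 : ℂ) := by
  have hz : 0 < ((y : ℂ) * I).im := by simpa using hy
  obtain ⟨x, hx⟩ : ∃ x : ℂ, x = rexp (-π * y) := ⟨_, rfl⟩
  have q1 : cexp (2 * π * I * (2 * (y * I))) = x ^ 4 := by
    rw [hx, Complex.ofReal_exp, ← Complex.exp_nat_mul]
    congr 1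
    push_cast
    linear_combination (4 * π * y : ℂ) * I_sq
  have q2 : cexp (2 * π * I * ((y * I + 1) / 2)) = -x := by
    rw [show 2 * π * I * ((y * I + 1) / 2) = ((-π * y : ℝ) : ℂ) + π * I by
      push_cast; linear_combination (π * y : ℂ) * I_sq, Complex.exp_add, Complex.exp_pi_mul_I, hx,
      Complex.ofReal_exp]
    ring
  have h1 := hasSum_eisensteinTwo (im_two_mul_pos hz)
  have h2 := hasSum_eisensteinTwo (im_add_one_half_pos hz)
  rw [q1] at h1
  rw [q2] at h2
  have h1' : HasSum (fun n : ℕ ↦ if 4 ∣ n then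
      (if n / 4 = 0 then 1 else -24 * ArithmeticFunction.sigma 1 (n / 4) : ℂ) * x ^ n else 0)
      (eisensteinTwo (2 * (y * I))) := by
    rw [← (mul_right_injective₀ (four_ne_zero : (4 : ℕ) ≠ 0)).hasSum_iff]
    · convert! h1 using 2 with m
      simp [pow_mul]
    · intro n hn
      rw [if_neg]
      rintro ⟨m, rfl⟩
      exact hn ⟨m, rfl⟩
  have h3 := (((h1'.mul_left 4).sub h2).div_const 3).sub (hasSum_ite_eq (0 : ℕ) (1 : ℂ))
  rw [Complex.ofReal_pow, theta4_eq_thetaFour, thetaFour_mul_I_pow_four hy]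
  convert! h3 using 2 with n
  rcases eq_or_ne n 0 with rfl | hn
  · norm_num [paperC_zero]
  have hxn : (rexp (-π * n * y) : ℂ) = x ^ n := by
    rw [hx, ← Complex.ofReal_pow, ← Real.exp_nat_mul]
    ring_nf
  rw [paperC_eq hn, hxn, if_neg hn, if_neg hn, neg_pow]
  push_cast
  split_ifs with h4 h5
  · lia
  · ring
  · ring

lemma hasSum_mellin_theta4_pow_four_sub_one {s : ℂ} (hs : 2 < s.re) :
    HasSum (fun n : ℕ ↦ (π : ℂ) ^ (-s) * Complex.Gamma s * (-8 * (paperC n : ℂ)) / (n : ℂ) ^ s)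
      (mellin (fun y ↦ ((theta4 y ^ 4 : ℝ) - 1 : ℂ)) s) := by
  have h := hasSum_mellin_pi_mul (a := fun n : ℕ ↦ -8 * (paperC n : ℂ)) (q := fun n ↦ n) (s := s)
    (fun n ↦ ?_) (by linarith) (fun t ht ↦ hasSum_theta4_pow_four_sub_one ht) ?_
  · exact_mod_cast h
  · rcases eq_or_ne n 0 with rfl | hn
    · simp [paperC_zero]
    · exact Or.inr (by exact_mod_cast hn.bot_lt)
  · refine ((summable_norm_paperC_div_rpow hs).mul_left 8).congr fun n ↦ ?_
    rw [norm_mul, mul_div_assoc]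
    norm_num

/-- Integrability of a nontrivial nonnegative Dirichlet series of exponentials against a power. -/
lemma integrableOn_rpow_mul_tsum_exp {a : ℕ → ℝ} (ha : ∀ n, 0 ≤ a n) (ha0 : a 0 = 0)
    (ha1 : a 1 ≠ 0) {σ : ℝ} (hσ : 0 < σ) (hsum : Summable fun n : ℕ ↦ a n / (n : ℝ) ^ σ)
    (hexp : ∀ t : ℝ, 0 < t → Summable fun n : ℕ ↦ a n * rexp (-π * n * t)) :
    IntegrableOn (fun t : ℝ ↦ t ^ (σ - 1) * ∑' n : ℕ, a n * rexp (-π * n * t)) (Set.Ioi 0) := by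
  have h := hasSum_mellin_pi_mul (a := fun n : ℕ ↦ (a n : ℂ)) (q := fun n ↦ n) (s := σ)
    (F := fun t ↦ ((∑' n : ℕ, a n * rexp (-π * n * t) : ℝ) : ℂ))
    (fun n ↦ ?_) (by simpa) (fun t ht ↦ ?_) ?_
  · by_contra hint
    have e : mellin (fun t ↦ ((∑' n : ℕ, a n * rexp (-π * n * t) : ℝ) : ℂ)) σ =
        ((∫ t in Set.Ioi (0 : ℝ), t ^ (σ - 1) * ∑' n : ℕ, a n * rexp (-π * n * t) : ℝ) : ℂ) := by
      rw [mellin, ← integral_complex_ofReal]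
      refine setIntegral_congr_fun measurableSet_Ioi fun t ht ↦ ?_
      simp only [smul_eq_mul]
      rw [Complex.ofReal_mul, Complex.ofReal_cpow (le_of_lt ht)]
      push_cast
      rfl
    rw [e, integral_undef hint] at h
    have h' : HasSum (fun n : ℕ ↦ π ^ (-σ) * Real.Gamma σ * a n / (n : ℝ) ^ σ) 0 := by
      rw [← Complex.hasSum_ofReal]
      convert! h using 2 with n
      rw [Complex.Gamma_ofReal]
      push_cast [Complex.ofReal_cpow pi_pos.le, Complex.ofReal_cpow (Nat.cast_nonneg n)]
      rfl
    have hG := Real.Gamma_pos_of_pos hσ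
    rw [hasSum_zero_iff_of_nonneg fun n ↦ by have := ha n; positivity] at h'
    have h1 := congr_fun h' 1
    have hpi : π ^ (-σ) ≠ 0 := (Real.rpow_pos_of_pos pi_pos _).ne'
    simp [ha1, hG.ne', hpi] at h1
  · rcases eq_or_ne n 0 with rfl | hn
    · simp [ha0]
    · exact Or.inr (by exact_mod_cast hn.bot_lt)
  · exact_mod_cast (hexp t ht).hasSum
  · simpa [abs_of_nonneg (ha _)] using hsum

lemma continuousOn_theta4 : ContinuousOn theta4 (Set.Ioi 0) := by
  have h : ContinuousOn (fun y : ℝ ↦ (theta4 y : ℂ)) (Set.Ioi 0) := fun y hy ↦ by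
    simp_rw [theta4_eq_thetaFour]
    refine ContinuousAt.continuousWithinAt ?_
    refine ContinuousAt.comp (f := fun y : ℝ ↦ (y : ℂ) * I) (g := thetaFour) ?_ (by fun_prop)
    exact (differentiableAt_thetaFour (by simpa using hy)).continuousAt
  simpa [Function.comp_def] using Complex.continuous_re.comp_continuousOn h

lemma integrableOn_cpow_mul_theta4_pow_four_sub_one {s : ℂ} (hs : 2 < s.re) :
    IntegrableOn (fun y : ℝ ↦ (y : ℂ) ^ (s - 1) * ((theta4 y ^ 4 : ℝ) - 1 : ℂ)) (Set.Ioi 0) := by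
  have hexp (t : ℝ) (ht : 0 < t) :
      Summable fun n : ℕ ↦ ‖-8 * (paperC n : ℂ)‖ * rexp (-π * n * t) := by
    refine (hasSum_theta4_pow_four_sub_one ht).summable.norm.congr fun n ↦ ?_
    rw [norm_mul, Complex.norm_of_nonneg (Real.exp_pos _).le]
  have hg := integrableOn_rpow_mul_tsum_exp (a := fun n ↦ ‖-8 * (paperC n : ℂ)‖) (σ := s.re)
    (fun n ↦ norm_nonneg _) (by simp [paperC_zero]) (by simp [paperC]) (by linarith)
    (((summable_norm_paperC_div_rpow hs).mul_left 8).congr fun n ↦ by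
      rw [norm_mul, mul_div_assoc]
      norm_num) hexp
  refine Integrable.mono' hg ?_ ?_
  · refine ContinuousOn.aestronglyMeasurable (fun y hy ↦ ?_) measurableSet_Ioi
    refine ContinuousWithinAt.mul ?_ ?_
    · exact (Complex.continuousAt_ofReal_cpow_const y _ (Or.inr (ne_of_gt hy))).continuousWithinAt
    · exact (Complex.continuous_ofReal.continuousAt.comp_continuousWithinAt
        ((continuousOn_theta4 y hy).pow 4)).sub continuousWithinAt_const
  · refine (ae_restrict_iff' measurableSet_Ioi).mpr (.of_forall fun y (hy : 0 < y) ↦ ?_)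
    rw [norm_mul, Complex.norm_cpow_eq_rpow_re_of_pos hy, Complex.sub_re, Complex.one_re]
    gcongr
    rw [← (hasSum_theta4_pow_four_sub_one hy).tsum_eq]
    refine (norm_tsum_le_tsum_norm ?_).trans_eq (tsum_congr fun n ↦ ?_)
    · exact (hasSum_theta4_pow_four_sub_one hy).summable.norm
    · rw [norm_mul, Complex.norm_of_nonneg (Real.exp_pos _).le]

theorem mellin_theta4_pow_four (s : ℂ) (hs : 2 < s.re) :
    IntegrableOn (fun y : ℝ => (y : ℂ) ^ (s - 1) * ((theta4 y ^ 4 : ℝ) - 1 : ℂ))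
      (Set.Ioi 0) ∧
    ∫ y in Set.Ioi (0 : ℝ), (y : ℂ) ^ (s - 1) * ((theta4 y ^ 4 : ℝ) - 1 : ℂ) =
      -8 * (π : ℂ) ^ (-s) * Complex.Gamma s * ∑' k : ℕ, (paperC k : ℂ) * (k : ℂ) ^ (-s) := by
  refine ⟨integrableOn_cpow_mul_theta4_pow_four_sub_one hs, ?_⟩
  have h := (hasSum_mellin_theta4_pow_four_sub_one hs).tsum_eq
  simp only [mellin, smul_eq_mul] at h
  rw [← h, ← tsum_mul_left]
  refine tsum_congr fun n ↦ ?_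
  rw [Complex.cpow_neg (n : ℂ)]
  ring
end
end
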